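/- arXiv:1107.5390 — 4 statements merged into one kernel-verified Lean document; each statement's English description precedes it below -/
import Mathlib

section
/- Let n be a real number and Ω : ℝ × ℝ → ℝ be a differentiable function. Suppose x, y : ℝ → ℝ are twice differentiable functions satisfying the equations of motion x''(t) − 2n·y'(t) = ∂Ω/∂x (x(t), y(t)) and y''(t) + 2n·x'(t) = ∂Ω/∂y (x(t), y(t)) for all t ∈ ℝ. Then the Jacobi function t ↦ 2·Ω(x(t), y(t)) − x'(t)² − y'(t)² is constant on ℝ. -/
/-- The Jacobi (energy) integral: solutions of the planar rotating-frame
equations of motion `x'' - 2n y' = Ω_x`, `y'' + 2n x' = Ω_y` make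
`2Ω - x'² - y'²` constant. -/
theorem jacobi_integral_constant (n : ℝ) (Ω : ℝ × ℝ → ℝ) (x y : ℝ → ℝ)
    (hΩ : Differentiable ℝ Ω)
    (hx : Differentiable ℝ x) (hx' : Differentiable ℝ (deriv x))
    (hy : Differentiable ℝ y) (hy' : Differentiable ℝ (deriv y))
    (heqx : ∀ t : ℝ, deriv (deriv x) t - 2 * n * deriv y t
      = fderiv ℝ Ω (x t, y t) (1, 0))
    (heqy : ∀ t : ℝ, deriv (deriv y) t + 2 * n * deriv x t
      = fderiv ℝ Ω (x t, y t) (0, 1)) :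
    ∀ t s : ℝ,
      2 * Ω (x t, y t) - (deriv x t) ^ 2 - (deriv y t) ^ 2
        = 2 * Ω (x s, y s) - (deriv x s) ^ 2 - (deriv y s) ^ 2 := by
  have hJ : ∀ t : ℝ, HasDerivAt
      (fun t => 2 * Ω (x t, y t) - (deriv x t) ^ 2 - (deriv y t) ^ 2) 0 t := by
    intro t
    have hΩt : HasDerivAt (fun t => Ω (x t, y t))
        (fderiv ℝ Ω (x t, y t) (deriv x t, deriv y t)) t :=
      (hΩ (x t, y t)).hasFDerivAt.comp_hasDerivAt t
        ((hx t).hasDerivAt.prodMk (hy t).hasDerivAt)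
    have hsplit : fderiv ℝ Ω (x t, y t) (deriv x t, deriv y t)
        = deriv x t * fderiv ℝ Ω (x t, y t) (1, 0)
          + deriv y t * fderiv ℝ Ω (x t, y t) (0, 1) := by
      rw [← smul_eq_mul, ← smul_eq_mul, ← map_smul, ← map_smul, ← map_add]
      simp
    refine (((hΩt.const_mul 2).sub ((hx' t).hasDerivAt.pow 2)).sub
      ((hy' t).hasDerivAt.pow 2)).congr_deriv ?_
    rw [hsplit, ← heqx, ← heqy]
    push_cast
    ring
  exact is_const_of_deriv_eq_zero (fun t => (hJ t).differentiableAt) fun t => (hJ t).deriv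
end

section
/- Let μ, q₁, A₂, c, h, a, b, n be real numbers with 0 < μ < 1, q₁ > 0, A₂ ≥ 0, c > 0, h > 0, 0 < a < b and n > 0. Define K₂(x) = n²·x − (1−μ)·q₁/(x+μ)² + μ/(x+μ−1)² + (3/2)·μ·A₂/(x+μ−1)⁴ − 2·c·h·π·(b−a)/(a·b)·(1/x²) − (3/8)·c·h·π·(ln b − ln a)/x³. Then there exists a real number x with 0 < x < 1 − μ and K₂(x) = 0. -/
/-- If the disk coefficients `P`, `Q` of `x⁻²`, `x⁻³` enter with `Q > 0`, the collinear
equilibrium function without oblateness vanishes somewhere in `(0, 1 - μ)`. -/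
lemma exists_zero_of_no_oblateness {μ Q : ℝ} (q P n : ℝ) (hμ0 : 0 < μ) (hμ1 : μ < 1)
    (hQ : 0 < Q) :
    ∃ x : ℝ, 0 < x ∧ x < 1 - μ ∧
      n ^ 2 * x - (1 - μ) * q / (x + μ) ^ 2 + μ / (x + μ - 1) ^ 2
        - P * (1 / x ^ 2) - Q / x ^ 3 = 0 := by
  have hcont : ContinuousOn (fun x : ℝ =>
      (n ^ 2 * x - (1 - μ) * q / (x + μ) ^ 2) * (x ^ 3 * (x + μ - 1) ^ 2) + μ * x ^ 3
        - P * x * (x + μ - 1) ^ 2 - Q * (x + μ - 1) ^ 2) (Set.Icc 0 (1 - μ)) := by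
    have hne : ∀ x ∈ Set.Icc (0 : ℝ) (1 - μ), (x + μ) ^ 2 ≠ 0 := fun x hx =>
      pow_ne_zero _ (by linarith [hx.1])
    fun_prop (disch := assumption)
  have hL : 0 < 1 - μ := by linarith
  have h0 : 0 < Q * (μ - 1) ^ 2 := mul_pos hQ (sq_pos_of_neg (by linarith))
  have h1 : 0 < μ * (1 - μ) ^ 3 := by positivity
  obtain ⟨x, hx, hfx⟩ := intermediate_value_Ioo hL.le hcont
    (show (0 : ℝ) ∈ Set.Ioo _ _ from ⟨by simpa using h0, by simpa using h1⟩)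
  refine ⟨x, hx.1, hx.2, ?_⟩
  have hx0 : x ≠ 0 := hx.1.ne'
  have hxμ : x + μ ≠ 0 := by linarith [hx.1]
  have hxL : x + μ - 1 ≠ 0 := by linarith [hx.2]
  have hg : x ^ 3 * (x + μ - 1) ^ 2 ≠ 0 := by positivity
  refine (mul_eq_zero.mp ?_).resolve_right hg
  rw [← hfx]
  field_simp

/-- Existence of the collinear equilibrium point `L₂` in the interval `(0, 1-μ)`:
the equilibrium function `K₂` has a zero between the center of mass and the
smaller primary. -/
theorem exists_collinear_L2 (μ q₁ A₂ c h a b n : ℝ)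
    (hμ0 : 0 < μ) (hμ1 : μ < 1) (hq : 0 < q₁) (hA : 0 ≤ A₂)
    (hc : 0 < c) (hh : 0 < h) (ha : 0 < a) (hab : a < b) (hn : 0 < n) :
    ∃ x : ℝ, 0 < x ∧ x < 1 - μ ∧
      n ^ 2 * x - (1 - μ) * q₁ / (x + μ) ^ 2 + μ / (x + μ - 1) ^ 2
        + (3 / 2) * μ * A₂ / (x + μ - 1) ^ 4
        - 2 * c * h * Real.pi * (b - a) / (a * b) * (1 / x ^ 2)
        - (3 / 8) * c * h * Real.pi * (Real.log b - Real.log a) / x ^ 3 = 0 := by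
  have hlog : 0 < Real.log b - Real.log a := sub_pos.mpr (Real.log_lt_log ha hab)
  have hQ : 0 < (3 / 8) * c * h * Real.pi * (Real.log b - Real.log a) := by positivity
  generalize (3 / 8) * c * h * Real.pi * (Real.log b - Real.log a) = Q at hQ ⊢
  generalize 2 * c * h * Real.pi * (b - a) / (a * b) = P
  obtain ⟨y, hy0, hy1, hy⟩ := exists_zero_of_no_oblateness q₁ P n hμ0 hμ1 hQ
  have hcont : ContinuousOn (fun x : ℝ =>
      (n ^ 2 * x - (1 - μ) * q₁ / (x + μ) ^ 2 + μ / (x + μ - 1) ^ 2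
        + (3 / 2) * μ * A₂ / (x + μ - 1) ^ 4) * x ^ 3 - P * x - Q) (Set.Icc 0 y) := by
    have hne : ∀ x ∈ Set.Icc 0 y, (x + μ) ^ 2 ≠ 0 := fun x hx =>
      pow_ne_zero _ (by linarith [hx.1])
    have hne2 : ∀ x ∈ Set.Icc 0 y, (x + μ - 1) ^ 2 ≠ 0 := fun x hx =>
      pow_ne_zero _ (by linarith [hx.2])
    have hne4 : ∀ x ∈ Set.Icc 0 y, (x + μ - 1) ^ 4 ≠ 0 := fun x hx =>
      pow_ne_zero _ (by linarith [hx.2])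
    fun_prop (disch := assumption)
  have hval : 0 ≤ (n ^ 2 * y - (1 - μ) * q₁ / (y + μ) ^ 2 + μ / (y + μ - 1) ^ 2
        + (3 / 2) * μ * A₂ / (y + μ - 1) ^ 4) * y ^ 3 - P * y - Q := by
    have hpos : 0 ≤ (3 / 2) * μ * A₂ / (y + μ - 1) ^ 4 * y ^ 3 := by positivity
    have hmul : (n ^ 2 * y - (1 - μ) * q₁ / (y + μ) ^ 2 + μ / (y + μ - 1) ^ 2) * y ^ 3
        - P * y - Q = 0 := by
      rw [← zero_mul (y ^ 3), ← hy, sub_mul _ (Q / y ^ 3), sub_mul _ (P * (1 / y ^ 2)),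
        div_mul_cancel₀ Q (by positivity)]
      congr 2
      field_simp
    linarith
  obtain ⟨x, hx, hfx⟩ := intermediate_value_Ioc hy0.le hcont
    (show (0 : ℝ) ∈ Set.Ioc _ _ from ⟨by simpa using hQ, hval⟩)
  have hx0 : x ≠ 0 := hx.1.ne'
  refine ⟨x, hx.1, hx.2.trans_lt hy1, ?_⟩
  refine (mul_eq_zero.mp ?_).resolve_right (pow_ne_zero 3 hx0)
  rw [← hfx, sub_mul _ (Q / x ^ 3), sub_mul _ (P * (1 / x ^ 2)),
    div_mul_cancel₀ Q (pow_ne_zero 3 hx0)]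
  congr 2
  field_simp
end

section
/- Let μ, q₁, A₂, c, h, a, b, n be real numbers with 0 < μ < 1, q₁ > 0, A₂ ≥ 0, c > 0, h > 0, 0 < a < b and n > 0. Define K₃(x) = n²·x − (1−μ)·q₁/(x+μ)² + μ/(x+μ−1)² + (3/2)·μ·A₂/(x+μ−1)⁴ + 2·c·h·π·(b−a)/(a·b)·(1/x²) − (3/8)·c·h·π·(ln b − ln a)/x³. Then there exists a real number x with −μ < x < 0 and K₃(x) = 0. -/
/-- Existence of the new equilibrium point `l₁` in the interval `(-μ, 0)`:
in the presence of the disk (`a < b`) the equilibrium function `K₃` has a zero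
between the bigger primary and the center of mass. -/
theorem exists_new_point_l1 (μ q₁ A₂ c h a b n : ℝ)
    (hμ0 : 0 < μ) (hμ1 : μ < 1) (hq : 0 < q₁) (hA : 0 ≤ A₂)
    (hc : 0 < c) (hh : 0 < h) (ha : 0 < a) (hab : a < b) (hn : 0 < n) :
    ∃ x : ℝ, -μ < x ∧ x < 0 ∧
      n ^ 2 * x - (1 - μ) * q₁ / (x + μ) ^ 2 + μ / (x + μ - 1) ^ 2
        + (3 / 2) * μ * A₂ / (x + μ - 1) ^ 4
        + 2 * c * h * Real.pi * (b - a) / (a * b) * (1 / x ^ 2)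
        - (3 / 8) * c * h * Real.pi * (Real.log b - Real.log a) / x ^ 3 = 0 := by
  have hP : 0 < (1 - μ) * q₁ := mul_pos (by linarith) hq
  have hL : 0 < (3 / 8) * c * h * Real.pi * (Real.log b - Real.log a) :=
    mul_pos (by positivity) (sub_pos.mpr (Real.log_lt_log ha hab))
  generalize (1 - μ) * q₁ = P at hP ⊢
  generalize (3 / 8) * c * h * Real.pi * (Real.log b - Real.log a) = L at hL ⊢
  generalize 2 * c * h * Real.pi * (b - a) / (a * b) = D
  -- Clear the poles at `-μ` and `0`, then apply the intermediate value theorem on `[-μ, 0]`.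
  let G : ℝ → ℝ := fun x =>
    (n ^ 2 * x + μ / (x + μ - 1) ^ 2 + (3 / 2) * μ * A₂ / (x + μ - 1) ^ 4) * (x ^ 3 * (x + μ) ^ 2)
      - P * x ^ 3 + D * x * (x + μ) ^ 2 - L * (x + μ) ^ 2
  have hG : ContinuousOn G (Set.Icc (-μ) 0) := by
    have hne : ∀ x ∈ Set.Icc (-μ) 0, x + μ - 1 ≠ 0 := fun x hx => by linarith [hx.2]
    have h2 : ∀ x ∈ Set.Icc (-μ) 0, (x + μ - 1) ^ 2 ≠ 0 := fun x hx => pow_ne_zero 2 (hne x hx)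
    have h4 : ∀ x ∈ Set.Icc (-μ) 0, (x + μ - 1) ^ 4 ≠ 0 := fun x hx => pow_ne_zero 4 (hne x hx)
    fun_prop (disch := assumption)
  have hleft : 0 < G (-μ) := by
    have : G (-μ) = P * μ ^ 3 := by simp only [G]; ring
    rw [this]; positivity
  have hright : G 0 < 0 := by
    have : G 0 = -(L * μ ^ 2) := by simp only [G]; ring
    rw [this, neg_lt_zero]; positivity
  obtain ⟨x, ⟨hx1, hx2⟩, hx⟩ := intermediate_value_Ioo' (by linarith) hG ⟨hright, hleft⟩
  refine ⟨x, hx1, hx2, ?_⟩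
  have hx0 : x ≠ 0 := hx2.ne
  have hxμ : x + μ ≠ 0 := by linarith
  have key : (n ^ 2 * x - P / (x + μ) ^ 2 + μ / (x + μ - 1) ^ 2
      + (3 / 2) * μ * A₂ / (x + μ - 1) ^ 4 + D * (1 / x ^ 2) - L / x ^ 3)
        * (x ^ 3 * (x + μ) ^ 2) = G x := by
    simp only [G]
    generalize μ / (x + μ - 1) ^ 2 = u
    generalize (3 / 2) * μ * A₂ / (x + μ - 1) ^ 4 = v
    field_simp
    ring
  exact (mul_eq_zero.mp (key.trans hx)).resolve_right (by positivity)
end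

section
/- Let μ, q₁, A₂, c, h, a, b, n be real numbers with 0 < μ < 1, q₁ > 0, A₂ ≥ 0, c > 0, h > 0, 0 < a ≤ b and n > 0. Define K₄(x) = n²·x + (1−μ)·q₁/(x+μ)² + μ/(x+μ−1)² + (3/2)·μ·A₂/(x+μ−1)⁴ + 2·c·h·π·(b−a)/(a·b)·(1/x²) − (3/8)·c·h·π·(ln b − ln a)/x³. Then there exists a real number x with x < −μ and K₄(x) = 0. -/
/-- A linear term plus nonnegative multiples of inverse powers, one of them singular at `-μ`,
vanishes somewhere to the left of `-μ`. -/
theorem exists_lt_neg_linear_add_inv_pow_eq_zero {μ N p M C D E : ℝ} (hμ0 : 0 < μ) (hμ1 : μ < 1)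
    (hN : 0 < N) (hp : 0 < p) (hM : 0 ≤ M) (hC : 0 ≤ C) (hD : 0 ≤ D) (hE : 0 ≤ E) :
    ∃ x : ℝ, x < -μ ∧
      N * x + p / (x + μ) ^ 2 + M / (x + μ - 1) ^ 2 + C / (x + μ - 1) ^ 4
        + D * (1 / x ^ 2) - E / x ^ 3 = 0 := by
  set f : ℝ → ℝ := fun x => N * x + p / (x + μ) ^ 2 + M / (x + μ - 1) ^ 2 + C / (x + μ - 1) ^ 4
        + D * (1 / x ^ 2) - E / x ^ 3 with hf
  have hcont : ContinuousOn f (Set.Iio (-μ)) := by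
    intro x hx
    have hx' : x < -μ := hx
    have h1 : (x + μ) ^ 2 ≠ 0 := pow_ne_zero _ (by linarith)
    have h2 : (x + μ - 1) ^ 2 ≠ 0 := pow_ne_zero _ (by linarith)
    have h3 : (x + μ - 1) ^ 4 ≠ 0 := pow_ne_zero _ (by linarith)
    have h4 : x ^ 2 ≠ 0 := pow_ne_zero _ (by linarith)
    have h5 : x ^ 3 ≠ 0 := pow_ne_zero _ (by linarith)
    apply ContinuousAt.continuousWithinAt
    fun_prop (disch := assumption)
  have hcube : ∀ x : ℝ, -(E / x ^ 3) = E / (-x) ^ 3 := fun x => by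
    rw [Odd.neg_pow (by decide), div_neg]
  obtain ⟨y, hy, hfy⟩ : ∃ y < -μ, 0 ≤ f y := by
    set t := min 1 (p / (2 * N)) with ht
    have ht0 : 0 < t := lt_min one_pos (by positivity)
    have ht1 : t ≤ 1 := min_le_left _ _
    have htp : t * (2 * N) ≤ p := (le_div_iff₀ (by positivity)).1 (min_le_right _ _)
    refine ⟨-μ - t, by linarith, ?_⟩
    have hlead : 2 * N ≤ p / (-μ - t + μ) ^ 2 := by
      rw [show -μ - t + μ = -t by ring, neg_sq, le_div_iff₀ (by positivity)]
      nlinarith [mul_nonneg (mul_nonneg hN.le ht0.le) (sub_nonneg.2 ht1)]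
    have hM' : 0 ≤ M / (-μ - t + μ - 1) ^ 2 := by positivity
    have hC' : 0 ≤ C / (-μ - t + μ - 1) ^ 4 := div_nonneg hC (Even.pow_nonneg (by decide) _)
    have hD' : 0 ≤ D * (1 / (-μ - t) ^ 2) := by positivity
    have hE' : 0 ≤ E / (-(-μ - t)) ^ 3 := div_nonneg hE (pow_nonneg (by linarith) _)
    rw [← hcube] at hE'
    have hlin : -(2 * N) ≤ N * (-μ - t) := by nlinarith
    simp only [hf]
    linarith
  obtain ⟨z, hz, hfz⟩ : ∃ z < -μ, f z ≤ 0 := by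
    set S := p + M + C + D + E with hS
    have hS0 : 0 ≤ S := by positivity
    set T := 1 + S / N with hT
    have hT1 : 1 ≤ T := le_add_of_nonneg_right (by positivity)
    have hNT : N * T = N + S := by rw [hT]; field_simp
    refine ⟨-μ - T, by linarith, ?_⟩
    have hp' : p / (-μ - T + μ) ^ 2 ≤ p := div_le_self hp.le (by nlinarith)
    have hsq : 1 ≤ (-μ - T + μ - 1) ^ 2 := by nlinarith
    have hM' : M / (-μ - T + μ - 1) ^ 2 ≤ M := div_le_self hM hsq
    have hC' : C / (-μ - T + μ - 1) ^ 4 ≤ C := div_le_self hC (by nlinarith)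
    have hD' : D * (1 / (-μ - T) ^ 2) ≤ D := by
      rw [mul_one_div]
      exact div_le_self hD (by nlinarith)
    have hE' : E / (-(-μ - T)) ^ 3 ≤ E := div_le_self hE (one_le_pow₀ (by linarith))
    rw [← hcube] at hE'
    have hlin : N * (-μ - T) ≤ -S := by nlinarith
    simp only [hf]
    linarith
  obtain ⟨x, hx, hfx⟩ := isPreconnected_Iio.intermediate_value hz hy hcont ⟨hfz, hfy⟩
  exact ⟨x, hx, hfx⟩

/-- Existence of the collinear equilibrium point `L₃` in the interval `(-∞, -μ)`:
the equilibrium function `K₄` has a zero to the left of the bigger primary. -/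
theorem exists_collinear_L3 (μ q₁ A₂ c h a b n : ℝ)
    (hμ0 : 0 < μ) (hμ1 : μ < 1) (hq : 0 < q₁) (hA : 0 ≤ A₂)
    (hc : 0 < c) (hh : 0 < h) (ha : 0 < a) (hab : a ≤ b) (hn : 0 < n) :
    ∃ x : ℝ, x < -μ ∧
      n ^ 2 * x + (1 - μ) * q₁ / (x + μ) ^ 2 + μ / (x + μ - 1) ^ 2
        + (3 / 2) * μ * A₂ / (x + μ - 1) ^ 4
        + 2 * c * h * Real.pi * (b - a) / (a * b) * (1 / x ^ 2)
        - (3 / 8) * c * h * Real.pi * (Real.log b - Real.log a) / x ^ 3 = 0 := by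
  have hlog : 0 ≤ Real.log b - Real.log a := sub_nonneg.2 (Real.log_le_log ha hab)
  have hb : 0 < b := ha.trans_le hab
  have hba : 0 ≤ b - a := sub_nonneg.2 hab
  have hπ := Real.pi_pos
  have hμ' : 0 < 1 - μ := sub_pos.2 hμ1
  exact exists_lt_neg_linear_add_inv_pow_eq_zero hμ0 hμ1 (by positivity) (by positivity)
    hμ0.le (by positivity) (by positivity) (by positivity)
end
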